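/- Let C be a closed symmetric monoidal category with tensor unit 𝟙, and let X be an object of C such that the iterated canonical pairing maps μ_n(X) : (X^∨)^{⊗n} → (X^{⊗n})^∨ are isomorphisms for all n ≥ 0 (Condition 1) and the canonical map η_X : X → X^∨∨ is an isomorphism (Condition 2). Then the maps μ_n(X^∨) : ((X^∨)^∨)^{⊗n} → ((X^∨)^{⊗n})^∨ are isomorphisms for all n ≥ 0 if and only if the canonical maps η_{X^{⊗n}} : X^{⊗n} → (X^{⊗n})^∨∨ are isomorphisms for all n ≥ 0. (1-categorical version of the paper's Lemma 'cond 3'.) -/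

import Mathlib

set_option linter.unusedSectionVars false

open CategoryTheory MonoidalCategory MonoidalClosed

universe v u

namespace CoTHHFormal

variable (C : Type u) [Category.{v} C] [MonoidalCategory C] [SymmetricCategory C]
  [MonoidalClosed C]

/-- The linear dual of an object: `X^∨ = [X, 𝟙]`. -/
def dual (X : C) : C := (ihom X).obj (𝟙_ C)

variable {C}

/-- The linear dual of a morphism, acting contravariantly by precomposition in the
internal hom. -/
def dualMap {X Y : C} (f : X ⟶ Y) : dual C Y ⟶ dual C X :=
  (MonoidalClosed.pre f).app (𝟙_ C)

@[simp] lemma dualMap_id (X : C) : dualMap (𝟙 X) = 𝟙 (dual C X) := by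
  simp [dualMap, dual]

@[simp] lemma dualMap_comp {X Y Z : C} (f : X ⟶ Y) (g : Y ⟶ Z) :
    dualMap (f ≫ g) = dualMap g ≫ dualMap f := by
  unfold dualMap
  rw [MonoidalClosed.pre_map]
  rfl

variable (C)

/-- The evaluation map `X ⊗ X^∨ ⟶ 𝟙`. -/
def ev (X : C) : X ⊗ dual C X ⟶ 𝟙_ C := (ihom.ev X).app (𝟙_ C)

/-- The canonical map `η_X : X ⟶ X^∨∨`, adjoint under the tensor-hom adjunction to the
composite `X^∨ ⊗ X ≅ X ⊗ X^∨ → 𝟙` of the symmetry with the evaluation map. -/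
def eta (X : C) : X ⟶ dual C (dual C X) :=
  MonoidalClosed.curry ((β_ (dual C X) X).hom ≫ ev C X)

/-- The canonical pairing map `μ_{X,Y} : X^∨ ⊗ Y^∨ ⟶ (X ⊗ Y)^∨`, adjoint to the composite
of the symmetry rearrangement with the two evaluation maps. -/
def pairing (X Y : C) : dual C X ⊗ dual C Y ⟶ dual C (X ⊗ Y) :=
  MonoidalClosed.curry
    (tensorμ X Y (dual C X) (dual C Y) ≫ (ev C X ⊗ₘ ev C Y) ≫ (λ_ (𝟙_ C)).hom)

/-- The canonical map `μ_0 : 𝟙 ⟶ 𝟙^∨`. -/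
def pairingUnit : 𝟙_ C ⟶ dual C (𝟙_ C) :=
  MonoidalClosed.curry (λ_ (𝟙_ C)).hom

/-- Tensor powers of an object: `X^{⊗0} = 𝟙` and `X^{⊗(n+1)} = X^{⊗n} ⊗ X`. -/
def tpow (X : C) : ℕ → C
  | 0 => 𝟙_ C
  | n + 1 => tpow X n ⊗ X

/-- The iterated canonical pairing maps `μ_n(X) : (X^∨)^{⊗n} ⟶ (X^{⊗n})^∨`,
the lax monoidal structure maps of the linear dual functor. -/
def pairingPow (X : C) : (n : ℕ) → (tpow C (dual C X) n ⟶ dual C (tpow C X n))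
  | 0 => pairingUnit C
  | n + 1 => (pairingPow X n ▷ dual C X) ≫ pairing C (tpow C X n) X

/-- An object is dualizable if it admits an exact pairing with some object. -/
def Dualizable (X : C) : Prop := ∃ Y : C, Nonempty (ExactPairing X Y)

variable {C}

lemma tensorμ_braiding (A B X Y : C) :
    (β_ (A ⊗ B) (X ⊗ Y)).hom ≫ tensorμ X Y A B =
      tensorμ A B X Y ≫ ((β_ A X).hom ⊗ₘ (β_ B Y).hom) := by
  simp [tensorμ, SymmetricCategory.braiding_swap_eq_inv_braiding Y A,
    MonoidalCategory.tensorHom_def]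

/-- Two maps into a dual agree as soon as their composites with the evaluation map agree. -/
lemma dual_hom_ext {A X : C} {f g : A ⟶ dual C X}
    (h : X ◁ f ≫ ev C X = X ◁ g ≫ ev C X) : f = g :=
  MonoidalClosed.uncurry_injective ((uncurry_eq _).trans (h.trans (uncurry_eq _).symm))

lemma whiskerLeft_curry_ev {A X : C} (f : X ⊗ A ⟶ 𝟙_ C) :
    X ◁ (MonoidalClosed.curry f : A ⟶ dual C X) ≫ ev C X = f :=
  whiskerLeft_curry_ihom_ev_app _ _ _

lemma whiskerLeft_dualMap_ev {X Y : C} (f : X ⟶ Y) :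
    X ◁ dualMap f ≫ ev C X = f ▷ dual C Y ≫ ev C Y :=
  id_tensor_pre_app_comp_ev f (𝟙_ C)

lemma whiskerLeft_eta_ev (X : C) :
    dual C X ◁ eta C X ≫ ev C (dual C X) = (β_ (dual C X) X).hom ≫ ev C X :=
  whiskerLeft_curry_ev _

lemma whiskerLeft_pairing_ev (X Y : C) :
    (X ⊗ Y) ◁ pairing C X Y ≫ ev C (X ⊗ Y) =
      tensorμ X Y (dual C X) (dual C Y) ≫ (ev C X ⊗ₘ ev C Y) ≫ (λ_ (𝟙_ C)).hom :=
  whiskerLeft_curry_ev _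

/-- Transposing `f : A ⟶ X^∨` along the symmetry gives `η_X ≫ f^∨`. -/
lemma whiskerLeft_eta_dualMap_ev {A X : C} (f : A ⟶ dual C X) :
    A ◁ (eta C X ≫ dualMap f) ≫ ev C A = (β_ A X).hom ≫ X ◁ f ≫ ev C X := by
  rw [whiskerLeft_comp, Category.assoc, whiskerLeft_dualMap_ev, whisker_exchange_assoc,
    whiskerLeft_eta_ev, BraidedCategory.braiding_naturality_left_assoc]

lemma pairing_naturality_left {X X' : C} (f : X ⟶ X') (Y : C) :
    dualMap f ▷ dual C Y ≫ pairing C X Y = pairing C X' Y ≫ dualMap (f ▷ Y) := by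
  apply dual_hom_ext
  rw [whiskerLeft_comp, whiskerLeft_comp, Category.assoc, Category.assoc, whiskerLeft_pairing_ev,
    whiskerLeft_dualMap_ev, whisker_exchange_assoc, whiskerLeft_pairing_ev,
    ← tensorHom_id (dualMap f), ← tensorHom_id f, tensorμ_natural_right_assoc,
    tensorμ_natural_left_assoc, tensorHom_comp_tensorHom_assoc, tensorHom_comp_tensorHom_assoc,
    whiskerLeft_dualMap_ev]
  simp

lemma eta_dualMap_pairing (X Y : C) :
    eta C (X ⊗ Y) ≫ dualMap (pairing C X Y) =
      (eta C X ⊗ₘ eta C Y) ≫ pairing C (dual C X) (dual C Y) := by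
  apply dual_hom_ext
  rw [whiskerLeft_eta_dualMap_ev, whiskerLeft_pairing_ev, whiskerLeft_comp, Category.assoc,
    whiskerLeft_pairing_ev, tensorμ_natural_right_assoc, tensorHom_comp_tensorHom_assoc,
    whiskerLeft_eta_ev, whiskerLeft_eta_ev, ← Category.assoc, tensorμ_braiding, Category.assoc,
    tensorHom_comp_tensorHom_assoc]

lemma eta_dualMap_pairingUnit :
    eta C (𝟙_ C) ≫ dualMap (pairingUnit C) = pairingUnit C := by
  apply dual_hom_ext
  have h : 𝟙_ C ◁ pairingUnit C ≫ ev C (𝟙_ C) = (λ_ (𝟙_ C)).hom := whiskerLeft_curry_ev _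
  rw [whiskerLeft_eta_dualMap_ev, h]
  simp [← unitors_equal]

/-- Tensor powers of a morphism. -/
def tpowMap {X Y : C} (f : X ⟶ Y) : (n : ℕ) → (tpow C X n ⟶ tpow C Y n)
  | 0 => 𝟙 (𝟙_ C)
  | n + 1 => tpowMap f n ⊗ₘ f

instance isIso_tpowMap {X Y : C} (f : X ⟶ Y) [IsIso f] : ∀ n : ℕ, IsIso (tpowMap f n)
  | 0 => inferInstanceAs (IsIso (𝟙 (𝟙_ C)))
  | n + 1 =>
    have := isIso_tpowMap f n
    inferInstanceAs (IsIso (tpowMap f n ⊗ₘ f))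

instance isIso_dualMap {X Y : C} (f : X ⟶ Y) [IsIso f] : IsIso (dualMap f) :=
  ⟨dualMap (inv f), by rw [← dualMap_comp, IsIso.inv_hom_id, dualMap_id],
    by rw [← dualMap_comp, IsIso.hom_inv_id, dualMap_id]⟩

/-- The maps `η` are compatible with the iterated pairings of `X` and of `X^∨`. -/
lemma eta_dualMap_pairingPow (X : C) : ∀ n : ℕ,
    eta C (tpow C X n) ≫ dualMap (pairingPow C X n) =
      tpowMap (eta C X) n ≫ pairingPow C (dual C X) n
  | 0 => eta_dualMap_pairingUnit.trans (Category.id_comp _).symm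
  | n + 1 => by
    have ih := eta_dualMap_pairingPow X n
    change eta C (tpow C X n ⊗ X) ≫
        dualMap (pairingPow C X n ▷ dual C X ≫ pairing C (tpow C X n) X) =
      (tpowMap (eta C X) n ⊗ₘ eta C X) ≫ pairingPow C (dual C X) n ▷ dual C (dual C X) ≫
        pairing C (tpow C (dual C X) n) (dual C X)
    rw [dualMap_comp, ← Category.assoc, eta_dualMap_pairing, Category.assoc,
      ← pairing_naturality_left, ← Category.assoc, ← Category.assoc, ← tensorHom_id,
      ← tensorHom_id, tensorHom_comp_tensorHom, tensorHom_comp_tensorHom, ih]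

variable (C)

/-- Suppose `X` satisfies Condition 1 (all iterated pairing maps `μ_n(X)` are isomorphisms)
and Condition 2 (`η_X` is an isomorphism). Then `X^∨` satisfies Condition 1 if and only if
`X^{⊗n}` satisfies Condition 2 for all `n ≥ 0`. -/
theorem dual_cond1_iff_pow_cond2 (X : C)
    (h1 : ∀ n : ℕ, IsIso (pairingPow C X n)) (h2 : IsIso (eta C X)) :
    (∀ n : ℕ, IsIso (pairingPow C (dual C X) n)) ↔
      (∀ n : ℕ, IsIso (eta C (tpow C X n))) := by
  refine forall_congr' fun n => ?_
  have := h1 n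
  rw [← isIso_comp_left_iff (tpowMap (eta C X) n), ← eta_dualMap_pairingPow,
    isIso_comp_right_iff]

end CoTHHFormal
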